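/- arXiv:1501.03666 — 3 statements merged into one kernel-verified Lean document; each statement's English description precedes it below -/
import Mathlib

section
/- If u is a smooth solution of the Hunter–Saxton equation with u_{2x}(x,t) > 0 everywhere, then the identity ∂_t( u_{2x}^{1/2} ) = ∂_x( 2u · u_{2x}^{1/2} ) holds at every point (x,t); i.e., u_{2x}^{1/2} is a conserved density with flux 2u·u_{2x}^{1/2}. -/
/-- Partial derivative with respect to the first (space) variable. -/
noncomputable def pd1 (f : ℝ × ℝ → ℝ) (p : ℝ × ℝ) : ℝ := deriv (fun x => f (x, p.2)) p.1

/-- Partial derivative with respect to the second (time) variable. -/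
noncomputable def pd2 (f : ℝ × ℝ → ℝ) (p : ℝ × ℝ) : ℝ := deriv (fun t => f (p.1, t)) p.2

open scoped ContDiff

lemma hasDerivAt_pd1 {f : ℝ × ℝ → ℝ} {p : ℝ × ℝ} (hf : DifferentiableAt ℝ f p) :
    HasDerivAt (fun x => f (x, p.2)) (pd1 f p) p.1 := by
  have h : DifferentiableAt ℝ (fun x : ℝ => f (x, p.2)) p.1 :=
    DifferentiableAt.comp (g := f) p.1 hf (by fun_prop)
  exact h.hasDerivAt

lemma hasDerivAt_pd2 {f : ℝ × ℝ → ℝ} {p : ℝ × ℝ} (hf : DifferentiableAt ℝ f p) :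
    HasDerivAt (fun t => f (p.1, t)) (pd2 f p) p.2 := by
  have h : DifferentiableAt ℝ (fun t : ℝ => f (p.1, t)) p.2 :=
    DifferentiableAt.comp (g := f) p.2 hf (by fun_prop)
  exact h.hasDerivAt

lemma pd1_eq_fderiv {f : ℝ × ℝ → ℝ} {p : ℝ × ℝ} (hf : DifferentiableAt ℝ f p) :
    pd1 f p = fderiv ℝ f p (1, 0) :=
  (hf.hasFDerivAt.comp_hasDerivAt (f := fun x => (x, p.2)) p.1
    ((hasDerivAt_id p.1).prodMk (hasDerivAt_const p.1 p.2))).deriv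

lemma pd2_eq_fderiv {f : ℝ × ℝ → ℝ} {p : ℝ × ℝ} (hf : DifferentiableAt ℝ f p) :
    pd2 f p = fderiv ℝ f p (0, 1) :=
  (hf.hasFDerivAt.comp_hasDerivAt (f := fun t => (p.1, t)) p.2
    ((hasDerivAt_const p.2 p.1).prodMk (hasDerivAt_id p.2))).deriv

lemma contDiff_pd1 {f : ℝ × ℝ → ℝ} (hf : ContDiff ℝ ∞ f) : ContDiff ℝ ∞ (pd1 f) := by
  have h : pd1 f = fun p => fderiv ℝ f p (1, 0) :=
    funext fun p => pd1_eq_fderiv (hf.differentiable (by simp) p)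
  rw [h]
  exact (hf.fderiv_right (by simp)).clm_apply contDiff_const

/-- Partial derivatives of a smooth function commute. -/
lemma pd2_pd1_comm {f : ℝ × ℝ → ℝ} (hf : ContDiff ℝ ∞ f) (p : ℝ × ℝ) :
    pd2 (pd1 f) p = pd1 (pd2 f) p := by
  have hd : Differentiable ℝ f := hf.differentiable (by simp)
  have hd' : Differentiable ℝ (fderiv ℝ f) :=
    (hf.fderiv_right (m := ∞) (by simp)).differentiable (by simp)
  have h1 : pd1 f = fun p => fderiv ℝ f p (1, 0) := funext fun p => pd1_eq_fderiv (hd p)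
  have h2 : pd2 f = fun p => fderiv ℝ f p (0, 1) := funext fun p => pd2_eq_fderiv (hd p)
  have hv (v : ℝ × ℝ) : HasFDerivAt (fun q => fderiv ℝ f q v)
      ((fderiv ℝ (fderiv ℝ f) p).flip v) p := by
    simpa using (hd' p).hasFDerivAt.clm_apply (hasFDerivAt_const v p)
  rw [h1, h2, pd2_eq_fderiv (hv _).differentiableAt, pd1_eq_fderiv (hv _).differentiableAt,
    (hv _).fderiv, (hv _).fderiv]
  exact (contDiff_infty.1 hf 2).contDiffAt.isSymmSndFDerivAt (by simp) _ _

/-- If `u` is a smooth solution of the Hunter–Saxton equation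
`u_{xt} = 2 u u_{2x} + u_x²` with `u_{2x} > 0` everywhere, then
`∂_t (u_{2x}^{1/2}) = ∂_x (2 u · u_{2x}^{1/2})` at every point. -/
theorem hs_conservation_sqrt_u2x
    (u : ℝ × ℝ → ℝ) (hu : ContDiff ℝ (⊤ : ℕ∞) u)
    (hHS : ∀ p : ℝ × ℝ, pd2 (pd1 u) p = 2 * u p * pd1 (pd1 u) p + (pd1 u p) ^ 2)
    (hpos : ∀ p : ℝ × ℝ, 0 < pd1 (pd1 u) p) :
    ∀ p : ℝ × ℝ,
      pd2 (fun q => Real.sqrt (pd1 (pd1 u) q)) p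
        = pd1 (fun q => 2 * u q * Real.sqrt (pd1 (pd1 u) q)) p := by
  intro p
  have hu1 := contDiff_pd1 hu
  have hu2 := contDiff_pd1 hu1
  have du := hasDerivAt_pd1 (hu.differentiable (by simp) p)
  have du1 := hasDerivAt_pd1 (hu1.differentiable (by simp) p)
  have du2 := hasDerivAt_pd1 (hu2.differentiable (by simp) p)
  have du2t := hasDerivAt_pd2 (hu2.differentiable (by simp) p)
  have evol : pd2 (pd1 (pd1 u)) p
      = 4 * pd1 u p * pd1 (pd1 u) p + 2 * u p * pd1 (pd1 (pd1 u)) p := by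
    rw [pd2_pd1_comm hu1, funext hHS]
    refine (((du.const_mul 2).mul du2).add (du1.pow 2)).deriv.trans ?_
    push_cast
    ring
  have hs : Real.sqrt (pd1 (pd1 u) p) ≠ 0 := (Real.sqrt_pos.2 (hpos p)).ne'
  have lhs : pd2 (fun q => Real.sqrt (pd1 (pd1 u) q)) p
      = pd2 (pd1 (pd1 u)) p / (2 * Real.sqrt (pd1 (pd1 u) p)) :=
    (du2t.sqrt (hpos p).ne').deriv
  have rhs : pd1 (fun q => 2 * u q * Real.sqrt (pd1 (pd1 u) q)) p
      = 2 * pd1 u p * Real.sqrt (pd1 (pd1 u) p)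
        + 2 * u p * (pd1 (pd1 (pd1 u)) p / (2 * Real.sqrt (pd1 (pd1 u) p))) :=
    ((du.const_mul 2).mul (du2.sqrt (hpos p).ne')).deriv
  rw [lhs, rhs, evol]
  field_simp
  rw [Real.sq_sqrt (hpos p).le]
  ring
end

section
/- Let p : ℝ → ℝ be smooth with p never zero and set r := −p⁻¹. Then p² · ( 2 r‴ − 12 r⁻¹ r′ r″ + 12 r⁻² (r′)³ ) = 2 p‴ at every point; i.e., the change of variable p = −r⁻¹ linearizes the symmetry K⁽²⁾₃(r) = 2r_{3z} − 12r⁻¹r_z r_{2z} + 12r⁻²r_z³ into K⁽²⁾₃(p) = 2p_{3z}. -/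
theorem ContDiff.hasDerivAt_iteratedDeriv {p : ℝ → ℝ} (hp : ContDiff ℝ (⊤ : ℕ∞) p)
    (n : ℕ) (z : ℝ) : HasDerivAt (iteratedDeriv n p) (iteratedDeriv (n + 1) p z) z := by
  rw [iteratedDeriv_succ]
  exact (hp.differentiable_iteratedDeriv n (by exact_mod_cast ENat.natCast_lt_top n) z).hasDerivAt

theorem deriv_neg_inv_eq {p : ℝ → ℝ} (hp : ContDiff ℝ (⊤ : ℕ∞) p)
    (hne : ∀ z : ℝ, p z ≠ 0) :
    deriv (fun z => -(p z)⁻¹) = fun z => iteratedDeriv 1 p z / p z ^ 2 := by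
  funext z
  have h₀ : HasDerivAt p (iteratedDeriv 1 p z) z := by
    simpa using hp.hasDerivAt_iteratedDeriv 0 z
  rw [(h₀.fun_inv (hne z)).fun_neg.deriv]
  ring

theorem iteratedDeriv_two_neg_inv_eq {p : ℝ → ℝ} (hp : ContDiff ℝ (⊤ : ℕ∞) p)
    (hne : ∀ z : ℝ, p z ≠ 0) :
    iteratedDeriv 2 (fun z => -(p z)⁻¹) =
      fun z => iteratedDeriv 2 p z / p z ^ 2 - 2 * iteratedDeriv 1 p z ^ 2 / p z ^ 3 := by
  rw [iteratedDeriv_succ, iteratedDeriv_one, deriv_neg_inv_eq hp hne]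
  funext z
  have h₀ : HasDerivAt p (iteratedDeriv 1 p z) z := by
    simpa using hp.hasDerivAt_iteratedDeriv 0 z
  have h₁ := hp.hasDerivAt_iteratedDeriv 1 z
  have hz := hne z
  rw [(h₁.fun_div (h₀.fun_pow 2) (pow_ne_zero 2 hz)).deriv]
  field_simp
  push_cast
  ring

theorem iteratedDeriv_three_neg_inv_eq {p : ℝ → ℝ} (hp : ContDiff ℝ (⊤ : ℕ∞) p)
    (hne : ∀ z : ℝ, p z ≠ 0) :
    iteratedDeriv 3 (fun z => -(p z)⁻¹) =
      fun z => iteratedDeriv 3 p z / p z ^ 2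
        - 6 * iteratedDeriv 1 p z * iteratedDeriv 2 p z / p z ^ 3
        + 6 * iteratedDeriv 1 p z ^ 3 / p z ^ 4 := by
  rw [iteratedDeriv_succ, iteratedDeriv_two_neg_inv_eq hp hne]
  funext z
  have h₀ : HasDerivAt p (iteratedDeriv 1 p z) z := by
    simpa using hp.hasDerivAt_iteratedDeriv 0 z
  have h₁ := hp.hasDerivAt_iteratedDeriv 1 z
  have h₂ := hp.hasDerivAt_iteratedDeriv 2 z
  have hz := hne z
  rw [((h₂.fun_div (h₀.fun_pow 2) (pow_ne_zero 2 hz)).fun_sub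
    (((h₁.fun_pow 2).const_mul 2).fun_div (h₀.fun_pow 3) (pow_ne_zero 3 hz))).deriv]
  field_simp
  push_cast
  ring

/-- If `p` is smooth and never zero and `r := −p⁻¹`, then
`p² (2 r‴ − 12 r⁻¹ r′ r″ + 12 r⁻² (r′)³) = 2 p‴`; i.e. the change of variable
`p = −r⁻¹` linearizes `K⁽²⁾₃(r)` into `K⁽²⁾₃(p) = 2p_{3z}`. -/
theorem K23_linearized
    (p : ℝ → ℝ) (hp : ContDiff ℝ (⊤ : ℕ∞) p) (hne : ∀ z : ℝ, p z ≠ 0) :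
    ∀ z : ℝ,
      (p z) ^ 2 *
          (2 * iteratedDeriv 3 (fun z' => -(p z')⁻¹) z
            - 12 * ((fun z' => -(p z')⁻¹) z)⁻¹ * deriv (fun z' => -(p z')⁻¹) z *
                iteratedDeriv 2 (fun z' => -(p z')⁻¹) z
            + 12 * (((fun z' => -(p z')⁻¹) z) ^ 2)⁻¹ *
                (deriv (fun z' => -(p z')⁻¹) z) ^ 3)
        = 2 * iteratedDeriv 3 p z := by
  intro z
  have hz := hne z
  rw [iteratedDeriv_three_neg_inv_eq hp hne, iteratedDeriv_two_neg_inv_eq hp hne,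
    deriv_neg_inv_eq hp hne]
  field_simp
  ring
end

section
/- Let u : ℝ → ℝ be smooth with u′ never zero, let G : ℝ → ℝ be smooth, and set r₂ := (u′)⁻⁴ u″. Then the Euler–Lagrange expression of the density L = (u′)² G(r₂), namely E := −d/dx( 2u′ G(r₂) − 4 (u′)⁻³ u″ G′(r₂) ) + d²/dx²( (u′)⁻² G′(r₂) ), satisfies E = d/dx [ ( (u′)⁻⁶ u‴ − 4 (u′)⁻⁷ (u″)² ) G″(r₂) + 2 (u′)⁻³ u″ G′(r₂) − 2 u′ G(r₂) ]; i.e., the symmetry K₃(u) = ∂_x⁻¹ δ_u( u_x² G(r₂) ) equals (u_x⁻⁶u_{3x} − 4u_x⁻⁷u_{2x}²)G″(r₂) + 2u_x⁻³u_{2x}G′(r₂) − 2u_x G(r₂). -/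
/-- For smooth `u : ℝ → ℝ` with `u′` never zero and smooth `G`,
with `r₂ := (u′)⁻⁴ u″`, the Euler–Lagrange expression of `L = (u′)² G(r₂)`,
`E := −d/dx(2u′G(r₂) − 4(u′)⁻³u″G′(r₂)) + d²/dx²((u′)⁻²G′(r₂))`, satisfies
`E = d/dx[((u′)⁻⁶u‴ − 4(u′)⁻⁷(u″)²)G″(r₂) + 2(u′)⁻³u″G′(r₂) − 2u′G(r₂)]`. -/
theorem hs_K3_euler_lagrange
    (u : ℝ → ℝ) (hu : ContDiff ℝ (⊤ : ℕ∞) u) (hne : ∀ x : ℝ, deriv u x ≠ 0)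
    (G : ℝ → ℝ) (hG : ContDiff ℝ (⊤ : ℕ∞) G) :
    ∀ x : ℝ,
      -deriv (fun x' => 2 * deriv u x' * G (((deriv u x') ^ 4)⁻¹ * iteratedDeriv 2 u x')
            - 4 * ((deriv u x') ^ 3)⁻¹ * iteratedDeriv 2 u x' *
              deriv G (((deriv u x') ^ 4)⁻¹ * iteratedDeriv 2 u x')) x
        + iteratedDeriv 2 (fun x' => ((deriv u x') ^ 2)⁻¹ *
            deriv G (((deriv u x') ^ 4)⁻¹ * iteratedDeriv 2 u x')) x
      = deriv (fun x' =>
          (((deriv u x') ^ 6)⁻¹ * iteratedDeriv 3 u x'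
              - 4 * ((deriv u x') ^ 7)⁻¹ * (iteratedDeriv 2 u x') ^ 2) *
            deriv (deriv G) (((deriv u x') ^ 4)⁻¹ * iteratedDeriv 2 u x')
          + 2 * ((deriv u x') ^ 3)⁻¹ * iteratedDeriv 2 u x' *
            deriv G (((deriv u x') ^ 4)⁻¹ * iteratedDeriv 2 u x')
          - 2 * deriv u x' * G (((deriv u x') ^ 4)⁻¹ * iteratedDeriv 2 u x')) x := by
  intro x
  have hG' : ContDiff ℝ (⊤ : ℕ∞) (deriv G) := (contDiff_infty_iff_deriv.mp hG).2
  have hG'' : ContDiff ℝ (⊤ : ℕ∞) (deriv (deriv G)) := (contDiff_infty_iff_deriv.mp hG').2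
  have hu₁ : ContDiff ℝ (⊤ : ℕ∞) (deriv u) := (contDiff_infty_iff_deriv.mp hu).2
  have hu₂ : ContDiff ℝ (⊤ : ℕ∞) (deriv (deriv u)) := (contDiff_infty_iff_deriv.mp hu₁).2
  have iter_two (f : ℝ → ℝ) : iteratedDeriv 2 f = deriv (deriv f) := by
    rw [iteratedDeriv_succ, iteratedDeriv_one]
  have iter_three : iteratedDeriv 3 u = deriv (deriv (deriv u)) := by
    rw [iteratedDeriv_succ, iter_two]
  simp only [iter_two, iter_three]
  have hr : ContDiff ℝ (⊤ : ℕ∞) fun y => ((deriv u y) ^ 4)⁻¹ * deriv (deriv u) y :=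
    ((hu₁.pow 4).inv fun y => pow_ne_zero 4 (hne y)).mul hu₂
  have hB : ContDiff ℝ (⊤ : ℕ∞) fun y => ((deriv u y) ^ 2)⁻¹ *
      deriv G (((deriv u y) ^ 4)⁻¹ * deriv (deriv u) y) :=
    ((hu₁.pow 2).inv fun y => pow_ne_zero 2 (hne y)).mul (hG'.comp hr)
  have hA : ContDiff ℝ (⊤ : ℕ∞) fun y =>
      2 * deriv u y * G (((deriv u y) ^ 4)⁻¹ * deriv (deriv u) y)
        - 4 * ((deriv u y) ^ 3)⁻¹ * deriv (deriv u) y *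
          deriv G (((deriv u y) ^ 4)⁻¹ * deriv (deriv u) y) :=
    ((contDiff_const.mul hu₁).mul (hG.comp hr)).sub
      (((contDiff_const.mul ((hu₁.pow 3).inv fun y => pow_ne_zero 3 (hne y))).mul hu₂).mul
        (hG'.comp hr))
  have hB' := (contDiff_infty_iff_deriv.mp hB).2
  have top_ne : ((⊤ : ℕ∞) : WithTop ℕ∞) ≠ 0 := by simp
  rw [neg_add_eq_sub, ← deriv_fun_sub (hB'.differentiable top_ne x) (hA.differentiable top_ne x)]
  congr 1
  funext y
  have d₁ : HasDerivAt (deriv u) (deriv (deriv u) y) y :=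
    (hu₁.differentiable top_ne y).hasDerivAt
  have d₂ : HasDerivAt (deriv (deriv u)) (deriv (deriv (deriv u)) y) y :=
    (hu₂.differentiable top_ne y).hasDerivAt
  have dr := ((d₁.fun_pow 4).fun_inv (pow_ne_zero 4 (hne y))).fun_mul d₂
  have dG := ((hG'.differentiable top_ne
    (((deriv u y) ^ 4)⁻¹ * deriv (deriv u) y)).hasDerivAt).comp y dr
  have dB := ((d₁.fun_pow 2).fun_inv (pow_ne_zero 2 (hne y))).fun_mul dG
  simp only [Function.comp_def] at dB
  rw [dB.deriv]
  have h := hne y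
  generalize deriv (deriv G) _ = g₂
  generalize deriv G _ = g₁
  generalize G _ = g₀
  field_simp
  push_cast
  ring
end
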